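/- Crandall–Rabinowitz theorem on bifurcation from simple eigenvalues: under the stated hypotheses, (λ₀, u₀) is a bifurcation point of the equation F(λ, u) = 0 in the following sense: there exist ε₀ > 0, a neighborhood W of (λ₀, u₀) in ℝ × X, a C^{q−2} map ε ↦ (λ(ε), w(ε)) from (−ε₀, ε₀) to ℝ × X with (λ(0), w(0)) = (λ₀, u₀) and w'(0) = v₀, and a C^{q−2} map λ ↦ v(λ) defined for |λ − λ₀| small with v(λ₀) = u₀ and v'(λ₀) = 0, such that F(λ(ε), w(ε)) = 0 for all ε ∈ (−ε₀, ε₀), F(λ, v(λ)) = 0 for all λ near λ₀, the two solution curves Σ₁ := {(λ, v(λ))} and Σ₂ := {(λ(ε), w(ε))} intersect only at (λ₀, u₀), and every (λ, u) ∈ W with F(λ, u) = 0 belongs to Σ₁ ∪ Σ₂. -/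

import Mathlib

open Set

section
open Filter Topology

theorem cr_contDiff_integral {H : Type} [NormedAddCommGroup H] [NormedSpace ℝ H] [ProperSpace H]
    (n : ℕ) : ∀ {E : Type} [NormedAddCommGroup E] [NormedSpace ℝ E] (f : H × ℝ → E),
    ContDiff ℝ n f → ContDiff ℝ n (fun x => ∫ t in (0:ℝ)..1, f (x, t)) := by
  induction n with
  | zero =>
    intro E _ _ f hf
    have hc : Continuous f := hf.continuous
    rw [Nat.cast_zero, contDiff_zero]
    exact intervalIntegral.continuous_parametric_intervalIntegral_of_continuous' (by simpa [Function.uncurry_def] using hc) 0 1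
  | succ n ih =>
    intro E _ _ f hf
    have hc : Continuous f := hf.continuous
    have hf1 : ContDiff ℝ n (fderiv ℝ f) := hf.fderiv_right (by norm_cast)
    have hd : Differentiable ℝ f := hf.differentiable (by simp)
    set f' : H × ℝ → (H →L[ℝ] E) := fun p => (fderiv ℝ f p).comp (ContinuousLinearMap.inl ℝ H ℝ) with hf'
    have hf'c : ContDiff ℝ n f' := hf1.clm_comp contDiff_const
    have key : ∀ x, HasFDerivAt (fun x => ∫ t in (0:ℝ)..1, f (x, t)) (∫ t in (0:ℝ)..1, f' (x,t)) x := by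
      intro x₀
      have hcomp : IsCompact (Metric.closedBall x₀ 1 ×ˢ Icc (0:ℝ) 1) :=
        (isCompact_closedBall x₀ 1).prod isCompact_Icc
      obtain ⟨C, hC⟩ := hcomp.exists_bound_of_continuousOn hf'c.continuous.continuousOn
      refine intervalIntegral.hasFDerivAt_integral_of_dominated_of_fderiv_le (s := Metric.ball x₀ 1)
        (F := fun x t => f (x,t)) (F' := fun x t => f' (x,t)) (bound := fun _ => C)
        (Metric.ball_mem_nhds _ one_pos) ?_ ?_ ?_ ?_ ?_ ?_
      · refine Eventually.of_forall fun x => ?_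
        exact (by fun_prop : Continuous fun t => f (x,t)).aestronglyMeasurable
      · exact (by fun_prop : Continuous fun t => f (x₀,t)).intervalIntegrable _ _
      · have := hf'c.continuous
        exact (by fun_prop : Continuous fun t => f' (x₀,t)).aestronglyMeasurable
      · refine Eventually.of_forall fun t ht x hx => hC _ ⟨Metric.ball_subset_closedBall hx, ?_⟩
        rw [uIoc_of_le zero_le_one] at ht
        exact ⟨ht.1.le, ht.2⟩
      · simp
      · refine Eventually.of_forall fun t ht x hx => ?_
        exact (hd (x,t)).hasFDerivAt.comp x (hasFDerivAt_prodMk_left x t)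
    rw [Nat.cast_add, Nat.cast_one, contDiff_succ_iff_hasFDerivAt]
    refine ⟨_, ?_, key⟩
    exact ih f' hf'c

/-- second-order Hadamard -/
theorem cr_hadamard {E : Type} [NormedAddCommGroup E] [NormedSpace ℝ E] [ProperSpace E]
    (n : ℕ) (g : E → ℝ) (hg : ContDiff ℝ (n + 2 : ℕ) g) (h0 : g 0 = 0) (h1 : fderiv ℝ g 0 = 0) :
    ∃ h : ℝ × E → ℝ, ContDiff ℝ n h ∧ (∀ r e, g (r • e) = r ^ 2 * h (r, e)) ∧
      ∀ e, h (0, e) = (1 / 2) * fderiv ℝ (fderiv ℝ g) 0 e e := by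
  have hd1 : ContDiff ℝ (n + 1 : ℕ) (fderiv ℝ g) := hg.fderiv_right (by norm_cast)
  have hd2 : ContDiff ℝ n (fderiv ℝ (fderiv ℝ g)) := hd1.fderiv_right (by norm_cast)
  refine ⟨fun p => ∫ t in (0:ℝ)..1, (1 - t) * fderiv ℝ (fderiv ℝ g) ((t * p.1) • p.2) p.2 p.2, ?_, ?_, ?_⟩
  · refine cr_contDiff_integral n (fun q : (ℝ × E) × ℝ => (1 - q.2) * fderiv ℝ (fderiv ℝ g) ((q.2 * q.1.1) • q.1.2) q.1.2 q.1.2) ?_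
    have : ContDiff ℝ n (fun q : (ℝ × E) × ℝ => fderiv ℝ (fderiv ℝ g) ((q.2 * q.1.1) • q.1.2)) :=
      hd2.comp (by fun_prop)
    have := (this.clm_apply (by fun_prop : ContDiff ℝ n (fun q : (ℝ × E) × ℝ => q.1.2))).clm_apply (by fun_prop : ContDiff ℝ n (fun q : (ℝ × E) × ℝ => q.1.2))
    exact ContDiff.mul (by fun_prop) this
  · intro r e
    have hl : ∀ t : ℝ, HasDerivAt (fun t : ℝ => (t * r) • e) (r • e) t := by
      intro t
      simpa using ((hasDerivAt_id t).mul_const r).smul_const e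
    have hA : ∀ t : ℝ, HasDerivAt (fun t : ℝ => g ((t * r) • e)) (fderiv ℝ g ((t * r) • e) (r • e)) t := 
      fun t => ((hg.differentiable (by simp)) _).hasFDerivAt.comp_hasDerivAt t (hl t)
    have hB : ∀ t : ℝ, HasDerivAt (fun t : ℝ => fderiv ℝ g ((t * r) • e) (r • e)) 
        (fderiv ℝ (fderiv ℝ g) ((t * r) • e) (r • e) (r • e)) t := 
      fun t => (((hd1.differentiable (by simp)) _).hasFDerivAt.comp_hasDerivAt t (hl t)).clm_apply (hasDerivAt_const t (r • e)) |>.congr_deriv (by simp)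
    have hC : ∀ t : ℝ, HasDerivAt (fun t : ℝ => (1 - t) * fderiv ℝ g ((t * r) • e) (r • e) + g ((t * r) • e))
        ((1 - t) * fderiv ℝ (fderiv ℝ g) ((t * r) • e) (r • e) (r • e)) t := by
      intro t
      refine ((((hasDerivAt_id t).const_sub 1).mul (hB t)).add (hA t)).congr_deriv ?_
      simp
    have := intervalIntegral.integral_eq_sub_of_hasDerivAt (a := 0) (b := 1) (fun t _ => hC t) ?_
    · simp only [one_mul, zero_mul, sub_self, zero_smul, h0, h1] at this
      simp only [zero_apply, mul_zero, zero_add, sub_zero] at this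
      rw [← this, ← intervalIntegral.integral_const_mul]
      congr 1
      ext t
      simp
      ring
    · apply Continuous.intervalIntegrable
      have := hd2.continuous
      have h3 : Continuous fun t : ℝ => fderiv ℝ (fderiv ℝ g) ((t * r) • e) := by fun_prop
      exact ((continuous_const.sub continuous_id).mul ((h3.clm_apply continuous_const).clm_apply continuous_const))
  · intro e
    simp only [mul_zero, zero_smul]
    rw [intervalIntegral.integral_mul_const]
    congr 1
    rw [intervalIntegral.integral_sub (by simp) (by simp)]
    simp; norm_num

theorem cr_ift (n : ℕ) (hn : 1 ≤ n) (h : ℝ × (ℝ × ℝ) → ℝ) (hh : ContDiff ℝ n h)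
    (B : (ℝ × ℝ) →L[ℝ] (ℝ × ℝ) →L[ℝ] ℝ) (hB : ∀ x y, B x y = B y x)
    (h0 : ∀ e, h (0, e) = (1 / 2) * B e e) (e₀ e₁ : ℝ × ℝ) (he₀ : B e₀ e₀ = 0) (he₁ : B e₀ e₁ ≠ 0) :
    ∃ τ : ℝ → ℝ, ContDiffAt ℝ n τ 0 ∧ τ 0 = 0 ∧ (∀ᶠ x in 𝓝 (0:ℝ), h (x, e₀ + τ x • e₁) = 0) ∧
      ∀ᶠ p in 𝓝 ((0:ℝ), (0:ℝ)), h (p.1, e₀ + p.2 • e₁) = 0 → p.2 = τ p.1 := by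
  set K : ℝ × ℝ → ℝ := fun p => h (p.1, e₀ + p.2 • e₁) with hK
  have hKc : ContDiff ℝ n K := hh.comp (by fun_prop)
  have hKa : ContDiffAt ℝ n K (0, 0) := hKc.contDiffAt
  have hn0 : (n : WithTop ℕ∞) ≠ 0 := by
    exact_mod_cast (by omega : n ≠ 0)
  have hK0 : K (0, 0) = 0 := by simp [hK, h0, he₀]
  have hKt : ∀ t, K (0, t) = t * B e₀ e₁ + t ^ 2 * ((1 / 2) * B e₁ e₁) := by
    intro t
    simp only [hK, h0]
    simp [he₀, hB e₁ e₀]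
    ring
  have hder : fderiv ℝ K (0, 0) (0, 1) = B e₀ e₁ := by
    have h1 : HasDerivAt (fun t => K (0, t)) (fderiv ℝ K (0, 0) (0, 1)) 0 := by
      have := (hKc.differentiable hn0 (0, 0)).hasFDerivAt.comp_hasDerivAt (0:ℝ)
        ((hasDerivAt_const (0:ℝ) (0:ℝ)).prodMk (hasDerivAt_id (0:ℝ)))
      exact this
    have h2 : HasDerivAt (fun t => K (0, t)) (B e₀ e₁) 0 := by
      simp only [hKt]
      refine (((hasDerivAt_id (0:ℝ)).mul_const _).add (((hasDerivAt_id (0:ℝ)).pow 2).mul_const _)).congr_deriv ?_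
      simp
    exact h1.unique h2
  have hinv : (fderiv ℝ K (0, 0) ∘L .inr ℝ ℝ ℝ).IsInvertible := by
    refine ⟨ContinuousLinearEquiv.unitsEquivAut ℝ (Units.mk0 _ he₁), ?_⟩
    ext
    simp [hder]
  refine ⟨hKa.implicitFunction hn0 hinv, hKa.contDiffAt_implicitFunction hn0 hinv,
    hKa.implicitFunction_apply_self hn0 hinv, ?_, ?_⟩
  · filter_upwards [hKa.eventually_apply_implicitFunction hn0 hinv] with x hx
    rw [hK0] at hx
    exact hx
  · filter_upwards [hKa.eventually_apply_eq_iff_implicitFunction hn0 hinv] with p hp hp0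
    rw [hK0] at hp
    exact (hp.1 hp0).symm

theorem cr_global {E : Type} [NormedAddCommGroup E] [NormedSpace ℝ E] [FiniteDimensional ℝ E]
    (n : ℕ) (g : E → ℝ) (x : E) (hg : ContDiffAt ℝ n g x) :
    ∃ G : E → ℝ, ContDiff ℝ n G ∧ G =ᶠ[𝓝 x] g := by
  obtain ⟨u, hu, hgu⟩ := hg.contDiffOn (m := n) le_rfl (by simp)
  obtain ⟨r, hr, hru⟩ := Metric.mem_nhds_iff.1 hu
  let f : ContDiffBump x := ⟨r / 4, r / 2, by positivity, by linarith⟩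
  refine ⟨fun y => f y * g y, ?_, ?_⟩
  · rw [contDiff_iff_contDiffAt]
    intro y
    by_cases hy : y ∈ Metric.ball x r
    · have : ContDiffAt ℝ n g y := hgu.contDiffAt (mem_of_superset (Metric.isOpen_ball.mem_nhds hy) hru)
      exact (f.contDiff.contDiffAt).mul this
    · have : (fun y => f y * g y) =ᶠ[𝓝 y] fun _ => 0 := by
        have hy' : y ∉ tsupport f := by
          rw [f.tsupport_eq]
          simp only [Metric.mem_closedBall, Metric.mem_ball, not_le, not_lt] at hy ⊢
          show r / 2 < _
          linarith
        filter_upwards [notMem_tsupport_iff_eventuallyEq.1 hy'] with z hz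
        simp [hz]
      exact contDiffAt_const.congr_of_eventuallyEq this
  · filter_upwards [f.eventuallyEq_one] with y hy
    simp [hy]

set_option maxHeartbeats 1000000 in
theorem cr_planar (n : ℕ) (hn : 1 ≤ n) (g : ℝ × ℝ → ℝ) (hg : ContDiffAt ℝ (n + 2 : ℕ) g 0)
    (h0 : g 0 = 0) (h1 : fderiv ℝ g 0 = 0)
    (h11 : fderiv ℝ (fderiv ℝ g) 0 (1, 0) (1, 0) = 0)
    (h12 : fderiv ℝ (fderiv ℝ g) 0 (1, 0) (0, 1) ≠ 0) :
    ∃ τ σ : ℝ → ℝ, ContDiffAt ℝ n τ 0 ∧ ContDiffAt ℝ n σ 0 ∧ τ 0 = 0 ∧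
      (∀ᶠ x in 𝓝 (0:ℝ), g (x, x * τ x) = 0) ∧ (∀ᶠ x in 𝓝 (0:ℝ), g (x * σ x, x) = 0) ∧
      ∀ᶠ p in 𝓝 (0 : ℝ × ℝ), g p = 0 → p.2 = p.1 * τ p.1 ∨ p.1 = p.2 * σ p.2 := by
  obtain ⟨G, hG, hGg⟩ := cr_global (n + 2) g 0 hg
  have hGd : fderiv ℝ G =ᶠ[𝓝 0] fderiv ℝ g := hGg.fderiv
  have hB0 := hGd.fderiv_eq (𝕜 := ℝ)
  obtain ⟨h, hh, hGh, hhB⟩ := cr_hadamard n G hG (hGg.self_of_nhds.trans h0)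
    (hGd.self_of_nhds.trans h1)
  rw [hB0] at hhB
  set B : (ℝ × ℝ) →L[ℝ] (ℝ × ℝ) →L[ℝ] ℝ := fderiv ℝ (fderiv ℝ g) 0 with hBdef
  have hsymm : ∀ x y, B x y = B y x := by
    have := hg.isSymmSndFDerivAt (by simp)
    exact fun x y => this x y
  set b := B (1, 0) (0, 1) with hb
  set c := B (0, 1) (0, 1) with hc
  have hBe : ∀ x y : ℝ, B (x, y) (x, y) = 2 * b * x * y + c * y ^ 2 := by
    intro x y
    have : ((x, y) : ℝ × ℝ) = x • (1, 0) + y • (0, 1) := by simp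
    rw [this]
    simp only [map_add, map_smul, add_apply, smul_apply,
      h11, hsymm (0, 1) (1, 0), ← hb, ← hc, smul_eq_mul]
    ring
  have hBe2 : ∀ x : ℝ, B (x, 1) (1, 0) = b := by
    intro x
    have : ((x, 1) : ℝ × ℝ) = x • (1, 0) + (0, 1) := by simp
    rw [this]
    simp only [map_add, map_smul, add_apply, smul_apply,
      h11, hsymm (0, 1) (1, 0), ← hb, smul_eq_mul]
    ring
  set τ₀ := - c / (2 * b) with hτ₀
  have hcb : c = - 2 * b * τ₀ := by rw [hτ₀]; field_simp
  obtain ⟨τ, hτc, hτ0, hτs, hτu⟩ := cr_ift n hn h hh B hsymm hhB (1, 0) (0, 1) h11 h12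
  obtain ⟨ρ, hρc, hρ0, hρs, hρu⟩ := cr_ift n hn h hh B hsymm hhB (τ₀, 1) (1, 0)
    (by rw [hBe, hcb]; ring) (by rw [hBe2]; exact h12)
  have hτcont : ContinuousAt τ 0 := hτc.continuousAt
  have hρcont : ContinuousAt ρ 0 := hρc.continuousAt
  refine ⟨τ, fun x => τ₀ + ρ x, hτc, contDiffAt_const.add hρc, hτ0, ?_, ?_, ?_⟩
  · have : Tendsto (fun x => (x, x * τ x)) (𝓝 0) (𝓝 (0 : ℝ × ℝ)) := by
      have : ContinuousAt (fun x => (x, x * τ x)) 0 := by fun_prop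
      simpa [ContinuousAt, Prod.zero_eq_mk] using this
    filter_upwards [this.eventually hGg, hτs] with x hx hx2
    rw [← hx]
    have := hGh x ((1, 0) + τ x • (0, 1))
    rw [hx2] at this
    simpa using this
  · have : Tendsto (fun x => (x * (τ₀ + ρ x), x)) (𝓝 0) (𝓝 (0 : ℝ × ℝ)) := by
      have : ContinuousAt (fun x => (x * (τ₀ + ρ x), x)) 0 := by fun_prop
      simpa [ContinuousAt, Prod.zero_eq_mk] using this
    filter_upwards [this.eventually hGg, hρs] with x hx hx2
    rw [← hx]
    have := hGh x ((τ₀, 1) + ρ x • (1, 0))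
    rw [hx2] at this
    simpa using this
  · obtain ⟨η₁, hη₁, hτu⟩ := Metric.eventually_nhds_iff.1 hτu
    obtain ⟨η₂, hη₂, hρu⟩ := Metric.eventually_nhds_iff.1 hρu
    set η := min η₁ η₂ with hη
    have hη0 : 0 < η := lt_min hη₁ hη₂
    set S : Set (ℝ × ℝ) := Metric.sphere 0 1 ∩
      ({e | η * |e.1| ≤ |e.2|} ∩ {e | η * |e.2| ≤ |e.1 - τ₀ * e.2|}) with hS
    have hSc : IsCompact S := by
      refine (isCompact_sphere 0 1).inter_right (IsClosed.inter ?_ ?_)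
      · exact isClosed_le (by fun_prop) (by fun_prop)
      · exact isClosed_le (by fun_prop) (by fun_prop)
    have hSn : ∀ e ∈ S, h (0, e) ≠ 0 := by
      rintro ⟨x, y⟩ ⟨he1, he2, he3⟩ hz
      simp only [mem_ofPred_eq] at he2 he3
      rw [hhB, hBe, hcb] at hz
      have hz' : b * (y * (x - τ₀ * y)) = 0 := by linarith
      have hy : y = 0 := by
        rcases mul_eq_zero.1 ((mul_eq_zero.1 hz').resolve_left h12) with h | h
        · exact h
        · rw [h, abs_zero] at he3
          have := abs_nonneg y
          exact abs_eq_zero.1 (by nlinarith)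
      have hx : x = 0 := by
        rw [hy, abs_zero] at he2
        have := abs_nonneg x
        exact abs_eq_zero.1 (by nlinarith)
      rw [hx, hy] at he1
      simp at he1
    have hev : ∀ᶠ r in 𝓝 (0:ℝ), ∀ e ∈ S, h (r, e) ≠ 0 := by
      refine hSc.eventually_forall_of_forall_eventually fun e he => ?_
      exact hh.continuous.continuousAt.eventually_ne (hSn e he)
    have hnorm : Tendsto (fun p : ℝ × ℝ => ‖p‖) (𝓝 0) (𝓝 0) := tendsto_norm_zero
    have hball : ∀ᶠ p : ℝ × ℝ in 𝓝 0, ‖p‖ < η := by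
      exact hnorm.eventually (gt_mem_nhds hη0)
    filter_upwards [hGg, hnorm.eventually hev, hball] with p hp hpS hpη hgp
    rw [← hp] at hgp
    by_cases hp0 : p = 0
    · left; simp [hp0]
    have hpn : 0 < ‖p‖ := norm_pos_iff.2 hp0
    set e : ℝ × ℝ := ‖p‖⁻¹ • p with he
    have hpe : p = ‖p‖ • e := by rw [he, smul_smul, mul_inv_cancel₀ hpn.ne', one_smul]
    have hze : h (‖p‖, e) = 0 := by
      have := hGh ‖p‖ e
      rw [← hpe, hgp] at this
      have h2 : ‖p‖ ^ 2 ≠ 0 := by positivity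
      exact (mul_eq_zero.1 this.symm).resolve_left h2
    have hen : e ∈ Metric.sphere (0 : ℝ × ℝ) 1 := by
      simp [he, norm_smul, hpn.ne']
    have heS : e ∉ S := fun hc => hpS e hc hze
    have hp1 : |p.1| < η := (norm_fst_le p).trans_lt hpη
    have hp2 : |p.2| < η := (norm_snd_le p).trans_lt hpη
    have hcase : |p.2| < η * |p.1| ∨ |p.1 - τ₀ * p.2| < η * |p.2| := by
      by_contra hcon
      push Not at hcon
      apply heS
      have hinv : 0 < ‖p‖⁻¹ := inv_pos.2 hpn
      refine ⟨hen, ?_, ?_⟩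
      · simp only [mem_ofPred_eq, he, Prod.smul_fst, Prod.smul_snd, smul_eq_mul, abs_mul, abs_of_pos hinv]
        calc _ = ‖p‖⁻¹ * (η * |p.1|) := by ring
          _ ≤ _ := mul_le_mul_of_nonneg_left hcon.1 hinv.le
      · have : (‖p‖⁻¹ * p.1 - τ₀ * (‖p‖⁻¹ * p.2)) = ‖p‖⁻¹ * (p.1 - τ₀ * p.2) := by ring
        simp only [mem_ofPred_eq, he, Prod.smul_fst, Prod.smul_snd, smul_eq_mul, this, abs_mul, abs_of_pos hinv]
        calc _ = ‖p‖⁻¹ * (η * |p.2|) := by ring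
          _ ≤ _ := mul_le_mul_of_nonneg_left hcon.2 hinv.le
    rcases hcase with hcase | hcase
    · left
      have hx0 : p.1 ≠ 0 := by
        intro hx
        simp only [hx, abs_zero, mul_zero] at hcase
        exact absurd hcase (abs_nonneg _).not_gt
      have hpe2 : p = p.1 • (((1, 0) : ℝ × ℝ) + (p.2 / p.1) • (0, 1)) := by
        ext
        · simp
        · simp; field_simp
      have hz := hGh p.1 (((1, 0) : ℝ × ℝ) + (p.2 / p.1) • (0, 1))
      rw [← hpe2, hgp] at hz
      have hz := (mul_eq_zero.1 hz.symm).resolve_left (pow_ne_zero 2 hx0)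
      have := @hτu (p.1, p.2 / p.1) ?_ hz
      · simp only at this
        rw [← this]; field_simp
      · rw [Prod.dist_eq]
        simp only [Real.dist_eq, sub_zero, abs_div]
        refine max_lt (hp1.trans_le (min_le_left _ _)) ?_
        rw [div_lt_iff₀ (abs_pos.2 hx0)]
        exact hcase.trans_le (by gcongr; exact min_le_left _ _)
    · right
      have hx0 : p.2 ≠ 0 := by
        intro hx
        simp only [hx, abs_zero, mul_zero] at hcase
        exact absurd hcase (abs_nonneg _).not_gt
      have hpe2 : p = p.2 • (((τ₀, 1) : ℝ × ℝ) + (p.1 / p.2 - τ₀) • (1, 0)) := by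
        ext
        · simp; field_simp
        · simp
      have hz := hGh p.2 (((τ₀, 1) : ℝ × ℝ) + (p.1 / p.2 - τ₀) • (1, 0))
      rw [← hpe2, hgp] at hz
      have hz := (mul_eq_zero.1 hz.symm).resolve_left (pow_ne_zero 2 hx0)
      have := @hρu (p.2, p.1 / p.2 - τ₀) ?_ hz
      · simp only at this ⊢
        rw [← this]; field_simp; ring
      · rw [Prod.dist_eq]
        have h5 : p.1 / p.2 - τ₀ = (p.1 - τ₀ * p.2) / p.2 := by field_simp
        simp only [Real.dist_eq, sub_zero, h5, abs_div]
        refine max_lt (hp2.trans_le (min_le_right _ _)) ?_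
        rw [div_lt_iff₀ (abs_pos.2 hx0)]
        exact hcase.trans_le (by gcongr; exact min_le_right _ _)

theorem cr_functional {X Y : Type*} [NormedAddCommGroup X] [NormedSpace ℝ X]
    [NormedAddCommGroup Y] [NormedSpace ℝ Y] (Du : X →L[ℝ] Y)
    (hclosed : IsClosed (Set.range Du)) (w : Y) (hw : w ∉ Set.range Du)
    (hcod : ∀ y : Y, ∃ c : ℝ, y - c • w ∈ Set.range Du) :
    ∃ ℓ : Y →L[ℝ] ℝ, ℓ w = 1 ∧ (∀ x, ℓ (Du x) = 0) ∧ ∀ y, y ∉ Set.range Du → ℓ y ≠ 0 := by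
  have hconv : Convex ℝ (Set.range Du) := by
    have := (LinearMap.range (Du : X →ₗ[ℝ] Y)).convex
    rw [LinearMap.coe_range] at this
    exact this
  obtain ⟨f, u, hfu, hfb⟩ := geometric_hahn_banach_point_closed hconv hclosed hw
  have hu : u < 0 := by simpa using hfb 0 ⟨0, by simp⟩
  have hz : ∀ x, f (Du x) = 0 := by
    intro x
    by_contra hne
    have := hfb (Du ((u / f (Du x)) • x)) ⟨_, rfl⟩
    simp [hne] at this
  have hfw : f w ≠ 0 := (hfu.trans hu).ne
  refine ⟨(f w)⁻¹ • f, by simp [hfw], fun x => by simp [hz], fun y hy h0 => hy ?_⟩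
  obtain ⟨c, x, hx⟩ := hcod y
  have hfy : f y = 0 := by simpa [hfw] using h0
  have h2 := hz x
  rw [hx] at h2
  simp [hfy, hfw] at h2
  exact ⟨x, by rw [hx, h2]; simp⟩

theorem cr_snd_comp {E G : Type*} [NormedAddCommGroup E] [NormedSpace ℝ E]
    [NormedAddCommGroup G] [NormedSpace ℝ G] (f : G → ℝ) (γ : E → G) (x : E)
    (hf : ContDiffAt ℝ 2 f (γ x)) (hγ : ContDiffAt ℝ 2 γ x) (h0 : fderiv ℝ f (γ x) = 0) (a b : E) :
    fderiv ℝ (fderiv ℝ (f ∘ γ)) x a b =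
      fderiv ℝ (fderiv ℝ f) (γ x) (fderiv ℝ γ x a) (fderiv ℝ γ x b) := by
  have h1 : fderiv ℝ (f ∘ γ) =ᶠ[𝓝 x] fun y => (fderiv ℝ f (γ y)).comp (fderiv ℝ γ y) := by
    filter_upwards [hγ.continuousAt.eventually (hf.eventually (by simp)), hγ.eventually (by simp)] with y hy hy2
    exact fderiv_comp y (hy.differentiableAt (by simp)) (hy2.differentiableAt (by simp))
  have hf' : DifferentiableAt ℝ (fderiv ℝ f) (γ x) :=
    (hf.fderiv_right (m := 1) (by norm_num)).differentiableAt (by simp)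
  have hγ' : DifferentiableAt ℝ (fderiv ℝ γ) x :=
    (hγ.fderiv_right (m := 1) (by norm_num)).differentiableAt (by simp)
  have hγd : DifferentiableAt ℝ γ x := hγ.differentiableAt (by simp)
  rw [h1.fderiv_eq]
  have := (hf'.hasFDerivAt.comp x hγd.hasFDerivAt).clm_comp hγ'.hasFDerivAt
  have h3 := this.fderiv
  simp only [Function.comp_def] at h3
  rw [h3]
  simp [h0]

theorem cr_snd_post {G Y : Type*} [NormedAddCommGroup Y] [NormedSpace ℝ Y]
    [NormedAddCommGroup G] [NormedSpace ℝ G] (f : G → Y) (ℓ : Y →L[ℝ] ℝ) (x : G)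
    (hf : ContDiffAt ℝ 2 f x) (a b : G) :
    fderiv ℝ (fderiv ℝ (fun y => ℓ (f y))) x a b = ℓ (fderiv ℝ (fderiv ℝ f) x a b) := by
  have h1 : fderiv ℝ (fun y => ℓ (f y)) =ᶠ[𝓝 x] fun y => ℓ.comp (fderiv ℝ f y) := by
    filter_upwards [hf.eventually (by simp)] with y hy
    exact (ℓ.hasFDerivAt.comp y (hy.differentiableAt (by simp)).hasFDerivAt).fderiv
  have hf' : DifferentiableAt ℝ (fderiv ℝ f) x :=
    (hf.fderiv_right (m := 1) (by norm_num)).differentiableAt (by simp)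
  rw [h1.fderiv_eq]
  have := (hasFDerivAt_const ℓ x).clm_comp hf'.hasFDerivAt
  rw [this.fderiv]
  simp

theorem cr_LS {X Y : Type*}
    [NormedAddCommGroup X] [NormedSpace ℝ X] [CompleteSpace X]
    [NormedAddCommGroup Y] [NormedSpace ℝ Y] [CompleteSpace Y]
    (lam₀ : ℝ) (u₀ : X) (q : ℕ) (hq : q ≠ 0)
    (F : ℝ × X → Y) (hF : ContDiffAt ℝ q F (lam₀, u₀)) (hF0 : F (lam₀, u₀) = 0)
    (Du : X →L[ℝ] Y) (hDF : ∀ m x, fderiv ℝ F (lam₀, u₀) (m, x) = Du x)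
    (v₀ : X) (hker : Du v₀ = 0)
    (hker1 : ∀ x : X, Du x = 0 → ∃ c : ℝ, x = c • v₀)
    (w : Y) (hcod : ∀ y : Y, ∃ c : ℝ, y - c • w ∈ Set.range Du)
    (ℓ : Y →L[ℝ] ℝ) (hℓw : ℓ w = 1) (hℓ : ∀ x, ℓ (Du x) = 0)
    (φ : X →L[ℝ] ℝ) (hφ : φ v₀ = 1) :
    ∃ u : ℝ × ℝ → X, ContDiffAt ℝ q u 0 ∧ u 0 = u₀ ∧
      HasFDerivAt u ((ContinuousLinearMap.snd ℝ ℝ ℝ).smulRight v₀) 0 ∧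
      (∀ᶠ p in 𝓝 (0 : ℝ × ℝ), φ (u p - u₀) = p.2 ∧
        F (lam₀ + p.1, u p) = ℓ (F (lam₀ + p.1, u p)) • w) ∧
      ∀ᶠ z in 𝓝 (lam₀, u₀), F z = 0 → u (z.1 - lam₀, φ (z.2 - u₀)) = z.2 := by
  have hq0 : (q : WithTop ℕ∞) ≠ 0 := by exact_mod_cast hq
  set Φ : ℝ × X → ℝ × Y := fun z => (z.1, F z + (φ (z.2 - u₀) - ℓ (F z)) • w) with hΦ
  have hΦc : ContDiffAt ℝ q Φ (lam₀, u₀) := by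
    have h2 : ContDiffAt ℝ q (fun z => ℓ (F z)) (lam₀, u₀) := ℓ.contDiff.contDiffAt.comp _ hF
    refine contDiffAt_fst.prodMk (hF.add (ContDiffAt.smul (ContDiffAt.sub ?_ h2) contDiffAt_const))
    exact φ.contDiff.contDiffAt.comp _ (contDiffAt_snd.sub contDiffAt_const)
  set L : ℝ × X →L[ℝ] ℝ × Y := (ContinuousLinearMap.fst ℝ ℝ X).prod
    ((Du + φ.smulRight w).comp (ContinuousLinearMap.snd ℝ ℝ X)) with hL
  have hΦ' : HasFDerivAt Φ L (lam₀, u₀) := by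
    have hFd := (hF.differentiableAt hq0).hasFDerivAt
    have h2 := ℓ.hasFDerivAt.comp (lam₀, u₀) hFd
    have h3 := φ.hasFDerivAt.comp (lam₀, u₀) ((hasFDerivAt_snd (𝕜 := ℝ) (p := (lam₀, u₀))).sub_const u₀)
    have := (hasFDerivAt_fst (𝕜 := ℝ) (p := (lam₀, u₀))).prodMk (hFd.add ((h3.sub h2).smul_const w))
    refine this.congr_fderiv ?_
    refine ContinuousLinearMap.ext fun ⟨m, x⟩ => ?_
    simp [hL, hDF, hℓ]
  have hinj : L.ker = ⊥ := by
    rw [LinearMap.ker_eq_bot']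
    rintro ⟨m, x⟩ h
    simp only [hL, ContinuousLinearMap.coe_coe] at h
    simp at h
    obtain ⟨hm, hx⟩ := h
    have h4 : φ x = 0 := by
      have := congrArg ℓ hx
      simpa [hℓ, hℓw] using this
    rw [h4] at hx
    obtain ⟨c, rfl⟩ := hker1 x (by simpa using hx)
    have : c = 0 := by simpa [hφ] using h4
    simp [hm, this]
  have hsurj : L.range = ⊤ := by
    rw [LinearMap.range_eq_top]
    rintro ⟨m, y⟩
    obtain ⟨c, x, hx⟩ := hcod y
    refine ⟨(m, x + (c - φ x) • v₀), ?_⟩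
    simp [hL, hker, hφ, hx]
  set L' := ContinuousLinearEquiv.ofBijective L hinj hsurj with hL'
  have hLL' : (L' : ℝ × X →L[ℝ] ℝ × Y) = L := ContinuousLinearEquiv.coe_ofBijective L hinj hsurj
  rw [← hLL'] at hΦ'
  have hs := hΦc.hasStrictFDerivAt' hΦ' hq0
  have hbase : Φ (lam₀, u₀) = (lam₀, 0) := by simp [hΦ, hF0]
  have hΨc := hΦc.to_localInverse hΦ' hq0
  set Ψ := hs.localInverse Φ L' (lam₀, u₀) with hΨ
  have hΨc : ContDiffAt ℝ q Ψ (lam₀, 0) := by rw [← hbase]; exact hΨc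
  have hΨd : HasFDerivAt Ψ (L'.symm : ℝ × Y →L[ℝ] ℝ × X) (lam₀, 0) := by
    rw [← hbase]; exact hs.to_localInverse.hasFDerivAt
  have hΨ0 : Ψ (lam₀, 0) = (lam₀, u₀) := by rw [← hbase]; exact hs.localInverse_apply_image
  have hleft : ∀ᶠ z in 𝓝 (lam₀, u₀), Ψ (Φ z) = z := hs.eventually_left_inverse
  have hright : ∀ᶠ y in 𝓝 (lam₀, (0:Y)), Φ (Ψ y) = y := by
    rw [← hbase]; exact hs.eventually_right_inverse
  set A : ℝ × ℝ → ℝ × Y := fun p => (lam₀ + p.1, p.2 • w) with hA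
  have hA0 : A 0 = (lam₀, 0) := by simp [hA]
  have hAc : ContDiff ℝ q A := by fun_prop
  have hAd : HasFDerivAt A ((ContinuousLinearMap.fst ℝ ℝ ℝ).prod
      ((ContinuousLinearMap.snd ℝ ℝ ℝ).smulRight w)) 0 :=
    ((hasFDerivAt_fst (𝕜 := ℝ)).const_add lam₀).prodMk ((hasFDerivAt_snd (𝕜 := ℝ)).smul_const w)
  refine ⟨fun p => (Ψ (A p)).2, ?_, ?_, ?_, ?_, ?_⟩
  · have : ContDiffAt ℝ q (fun p => Ψ (A p)) 0 := by
      refine ContDiffAt.comp (0 : ℝ × ℝ) ?_ hAc.contDiffAt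
      rw [hA0]; exact hΨc
    exact this.snd
  · simp only [hA0, hΨ0]
  · rw [← hA0] at hΨd
    have := (hΨd.comp (0 : ℝ × ℝ) hAd).snd
    refine this.congr_fderiv ?_
    refine ContinuousLinearMap.ext fun ⟨m, s⟩ => ?_
    have h5 : L'.symm (m, s • w) = (m, s • v₀) := by
      rw [ContinuousLinearEquiv.symm_apply_eq]
      show _ = L (m, s • v₀)
      simp [hL, hker, hφ]
    simp [h5]
  · have hAt : Tendsto A (𝓝 0) (𝓝 (lam₀, 0)) := by
      rw [← hA0]; exact hAc.continuous.continuousAt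
    filter_upwards [hAt.eventually hright] with p hp
    simp only [hΦ, hA, Prod.mk.injEq] at hp
    obtain ⟨hp1, hp2⟩ := hp
    have hpair : (lam₀ + p.1, (Ψ (A p)).2) = Ψ (A p) := by
      ext
      · exact hp1.symm
      · rfl
    have h6 : φ ((Ψ (A p)).2 - u₀) = p.2 := by
      have := congrArg ℓ hp2
      simpa [hℓw] using this
    refine ⟨h6, ?_⟩
    rw [hpair]
    change F (Ψ (A p)) + (φ ((Ψ (A p)).2 - u₀) - ℓ (F (Ψ (A p)))) • w = p.2 • w at hp2
    rw [h6, sub_smul] at hp2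
    have : F (Ψ (A p)) - ℓ (F (Ψ (A p))) • w = 0 := by
      have h7 : F (Ψ (A p)) + (p.2 • w - ℓ (F (Ψ (A p))) • w) - p.2 • w = 0 := by rw [hp2, sub_self]
      rw [← h7]; abel
    exact sub_eq_zero.1 this
  · filter_upwards [hleft] with z hz hz0
    have : A (z.1 - lam₀, φ (z.2 - u₀)) = Φ z := by
      simp [hA, hΦ, hz0]
    simp only [this, hz]

end

open Filter Topology in
set_option maxHeartbeats 1000000 in
/-- **Crandall–Rabinowitz, bifurcation from a simple eigenvalue.**
Let `X, Y` be real Banach spaces, `F : ℝ × X → Y` a `C^q` map (`q ≥ 3`) on an open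
neighbourhood `U` of `(lam₀, u₀)`, with `F(lam₀,u₀) = 0` and `∂_λF(lam₀,u₀) = 0`.  Suppose
the partial Fréchet derivative `Du := ∂_uF(lam₀,u₀)` has a one-dimensional kernel
spanned by `v₀ ≠ 0` and a closed image of codimension one, and that the
transversality conditions `∂_λ∂_λF(lam₀,u₀) ∈ Im Du` and `∂_λ∂_uF(lam₀,u₀)[v₀] ∉ Im Du`
hold.  Then `(lam₀, u₀)` is a bifurcation point: near `(lam₀,u₀)` the solution set of
`F = 0` consists of two `C^{q-2}` curves `Σ₁ = {(λ, v(λ))}` and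
`Σ₂ = {(λ(ε), w(ε))}` which intersect only at `(lam₀, u₀)`, with
`v(lam₀) = u₀`, `v'(lam₀) = 0`, `(λ(0), w(0)) = (lam₀, u₀)` and `w'(0) = v₀`. -/
theorem crandall_rabinowitz
    {X Y : Type*}
    [NormedAddCommGroup X] [NormedSpace ℝ X] [CompleteSpace X]
    [NormedAddCommGroup Y] [NormedSpace ℝ Y] [CompleteSpace Y]
    (lam₀ : ℝ) (u₀ : X) (U : Set (ℝ × X)) (hU : IsOpen U) (hmem : (lam₀, u₀) ∈ U)
    (q : ℕ) (hq : 3 ≤ q)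
    (F : ℝ × X → Y) (hF : ContDiffOn ℝ q F U)
    -- (i)
    (hF0 : F (lam₀, u₀) = 0)
    (hFlam : deriv (fun l => F (l, u₀)) lam₀ = 0)
    -- the partial Fréchet derivative with respect to `u` at `(lam₀, u₀)`
    (Du : X →L[ℝ] Y) (hDu : Du = fderiv ℝ (fun x => F (lam₀, x)) u₀)
    -- (ii) one-dimensional kernel, spanned by `v₀`
    (v₀ : X) (hv₀ : v₀ ≠ 0) (hker : Du v₀ = 0)
    (hker1 : ∀ x : X, Du x = 0 → ∃ c : ℝ, x = c • v₀)
    -- (iii) closed image of codimension one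
    (hclosed : IsClosed (Set.range Du))
    (hcodim : ∃ w : Y, w ∉ Set.range Du ∧ ∀ y : Y, ∃ c : ℝ, y - c • w ∈ Set.range Du)
    -- (iv) transversality
    (hlamlam : deriv (deriv (fun l => F (l, u₀))) lam₀ ∈ Set.range Du)
    (hlamu : deriv (fun l => fderiv ℝ (fun x => F (l, x)) u₀ v₀) lam₀ ∉ Set.range Du) :
    ∃ (ε₀ δ : ℝ) (W : Set (ℝ × X)) (lam : ℝ → ℝ) (w : ℝ → X) (v : ℝ → X),
      0 < ε₀ ∧ 0 < δ ∧
      IsOpen W ∧ (lam₀, u₀) ∈ W ∧ W ⊆ U ∧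
      -- the second curve `Σ₂ : ε ↦ (λ(ε), w(ε))`
      ContDiffOn ℝ (q - 2 : ℕ) lam (Ioo (-ε₀) ε₀) ∧
      ContDiffOn ℝ (q - 2 : ℕ) w (Ioo (-ε₀) ε₀) ∧
      lam 0 = lam₀ ∧ w 0 = u₀ ∧ deriv w 0 = v₀ ∧
      (∀ ε ∈ Ioo (-ε₀) ε₀, (lam ε, w ε) ∈ U ∧ F (lam ε, w ε) = 0) ∧
      -- the trivial-type curve `Σ₁ : λ ↦ (λ, v(λ))`
      ContDiffOn ℝ (q - 2 : ℕ) v (Ioo (lam₀ - δ) (lam₀ + δ)) ∧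
      v lam₀ = u₀ ∧ deriv v lam₀ = 0 ∧
      (∀ l ∈ Ioo (lam₀ - δ) (lam₀ + δ), (l, v l) ∈ U ∧ F (l, v l) = 0) ∧
      -- the two curves intersect only at `(lam₀, u₀)`
      {p : ℝ × X | ∃ l ∈ Ioo (lam₀ - δ) (lam₀ + δ), p = (l, v l)} ∩
          {p : ℝ × X | ∃ ε ∈ Ioo (-ε₀) ε₀, p = (lam ε, w ε)} = {(lam₀, u₀)} ∧
      -- and, in `W`, they exhaust the solution set of `F = 0`
      (∀ p ∈ W, F p = 0 →
        p ∈ {p : ℝ × X | ∃ l ∈ Ioo (lam₀ - δ) (lam₀ + δ), p = (l, v l)} ∪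
            {p : ℝ × X | ∃ ε ∈ Ioo (-ε₀) ε₀, p = (lam ε, w ε)}) := by
  obtain ⟨n, rfl⟩ : ∃ n, q = n + 2 := ⟨q - 2, by omega⟩
  have hn : 1 ≤ n := by omega
  have hn0 : (n : WithTop ℕ∞) ≠ 0 := by exact_mod_cast (by omega : n ≠ 0)
  rw [Nat.add_sub_cancel]
  have hFa : ContDiffAt ℝ (n + 2 : ℕ) F (lam₀, u₀) := hF.contDiffAt (hU.mem_nhds hmem)
  have hFa2 : ContDiffAt ℝ 2 F (lam₀, u₀) := hFa.of_le (by norm_cast; omega)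
  have hFd : DifferentiableAt ℝ F (lam₀, u₀) := hFa2.differentiableAt (by simp)
  have hFd2 : DifferentiableAt ℝ (fderiv ℝ F) (lam₀, u₀) :=
    (hFa2.fderiv_right (m := 1) (by norm_num)).differentiableAt (by simp)
  have hpath : ∀ l : ℝ, HasDerivAt (fun l : ℝ => (l, u₀)) ((1 : ℝ), (0 : X)) l :=
    fun l => (hasDerivAt_id l).prodMk (hasDerivAt_const l u₀)
  have hnear : ∀ᶠ l in 𝓝 lam₀, DifferentiableAt ℝ F (l, u₀) := by
    have h1 := hFa2.eventually (by simp)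
    have h2 : Tendsto (fun l : ℝ => (l, u₀)) (𝓝 lam₀) (𝓝 (lam₀, u₀)) :=
      (hpath lam₀).continuousAt
    filter_upwards [h2.eventually h1] with l hl
    exact hl.differentiableAt (by simp)
  have hlam1 : ∀ l, DifferentiableAt ℝ F (l, u₀) →
      deriv (fun l => F (l, u₀)) l = fderiv ℝ F (l, u₀) (1, 0) :=
    fun l hl => (hl.hasFDerivAt.comp_hasDerivAt l (hpath l)).deriv
  have hu1 : ∀ l, DifferentiableAt ℝ F (l, u₀) → ∀ x,
      fderiv ℝ (fun x => F (l, x)) u₀ x = fderiv ℝ F (l, u₀) (0, x) := by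
    intro l hl x
    have := hl.hasFDerivAt.comp u₀ (hasFDerivAt_prodMk_right l u₀)
    have h2 := this.fderiv
    simp only [Function.comp_def] at h2
    rw [h2]
    simp
  have hDF : ∀ m x, fderiv ℝ F (lam₀, u₀) (m, x) = Du x := by
    intro m x
    have h1 : ((m, x) : ℝ × X) = m • (1, 0) + (0, x) := by simp
    rw [h1, map_add, map_smul, ← hlam1 _ hFd, hFlam, hDu, hu1 _ hFd]
    simp
  have hdd : ∀ b, HasDerivAt (fun l => fderiv ℝ F (l, u₀) b)
      (fderiv ℝ (fderiv ℝ F) (lam₀, u₀) (1, 0) b) lam₀ := by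
    intro b
    have := (hFd2.hasFDerivAt.comp_hasDerivAt lam₀ (hpath lam₀)).clm_apply (hasDerivAt_const lam₀ b)
    exact this.congr_deriv (by simp)
  have hD11 : deriv (deriv (fun l => F (l, u₀))) lam₀ =
      fderiv ℝ (fderiv ℝ F) (lam₀, u₀) (1, 0) (1, 0) := by
    have : deriv (fun l => F (l, u₀)) =ᶠ[𝓝 lam₀] fun l => fderiv ℝ F (l, u₀) (1, 0) := by
      filter_upwards [hnear] with l hl using hlam1 l hl
    rw [this.deriv_eq, (hdd _).deriv]
  have hD12 : deriv (fun l => fderiv ℝ (fun x => F (l, x)) u₀ v₀) lam₀ =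
      fderiv ℝ (fderiv ℝ F) (lam₀, u₀) (1, 0) (0, v₀) := by
    have : (fun l => fderiv ℝ (fun x => F (l, x)) u₀ v₀) =ᶠ[𝓝 lam₀]
        fun l => fderiv ℝ F (l, u₀) (0, v₀) := by
      filter_upwards [hnear] with l hl using hu1 l hl v₀
    rw [this.deriv_eq, (hdd _).deriv]
  rw [hD11] at hlamlam
  rw [hD12] at hlamu
  obtain ⟨w₁, hw₁, hcod⟩ := hcodim
  obtain ⟨ℓ, hℓw, hℓ, hℓne⟩ := cr_functional Du hclosed w₁ hw₁ hcod
  obtain ⟨φ, hφ⟩ : ∃ φ : StrongDual ℝ X, φ v₀ = 1 := SeparatingDual.exists_eq_one hv₀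
  obtain ⟨u, huc, hu0, hud, hus, huu⟩ := cr_LS lam₀ u₀ (n + 2) (by omega) F hFa hF0 Du hDF v₀ hker
    hker1 w₁ hcod ℓ hℓw hℓ φ hφ
  -- the reduced function
  set γ : ℝ × ℝ → ℝ × X := fun p => (lam₀ + p.1, u p) with hγ
  have hγ0 : γ 0 = (lam₀, u₀) := by simp [hγ, hu0]
  have hγc : ContDiffAt ℝ (n + 2 : ℕ) γ 0 :=
    (contDiffAt_const.add contDiffAt_fst).prodMk huc
  have hγd : HasFDerivAt γ ((ContinuousLinearMap.fst ℝ ℝ ℝ).prod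
      ((ContinuousLinearMap.snd ℝ ℝ ℝ).smulRight v₀)) 0 :=
    ((hasFDerivAt_fst (𝕜 := ℝ)).const_add lam₀).prodMk hud
  set f : ℝ × X → ℝ := fun z => ℓ (F z) with hf
  have hfc : ContDiffAt ℝ (n + 2 : ℕ) f (γ 0) := by
    rw [hγ0]; exact ℓ.contDiff.contDiffAt.comp _ hFa
  have hf1 : fderiv ℝ f (γ 0) = 0 := by
    rw [hγ0]
    refine (ℓ.hasFDerivAt.comp (lam₀, u₀) hFd.hasFDerivAt).fderiv.trans ?_
    refine ContinuousLinearMap.ext fun ⟨m, x⟩ => ?_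
    simp [hDF, hℓ]
  have hg2 : ∀ a b, fderiv ℝ (fderiv ℝ (f ∘ γ)) 0 a b =
      ℓ (fderiv ℝ (fderiv ℝ F) (lam₀, u₀) (a.1, a.2 • v₀) (b.1, b.2 • v₀)) := by
    intro a b
    rw [cr_snd_comp f γ 0 (hfc.of_le (by norm_cast; omega)) (hγc.of_le (by norm_cast; omega)) hf1,
      hγd.fderiv, hγ0, hf, cr_snd_post F ℓ _ hFa2]
    simp
  obtain ⟨τ, σ, hτc, hσc, hτ0, hτs, hσs, hex⟩ := cr_planar n hn (f ∘ γ) (hfc.comp 0 hγc)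
    (by simp [hγ0, hf, hF0])
    (by
      rw [fderiv_comp 0 (hfc.differentiableAt (by simp)) hγd.differentiableAt, hf1]
      simp)
    (by
      rw [hg2]
      obtain ⟨x, hx⟩ := hlamlam
      simp only [zero_smul]
      rw [← hx, hℓ])
    (by
      rw [hg2]
      simp only [zero_smul, one_smul]
      exact hℓne _ hlamu)
  have hτcont : ContinuousAt τ 0 := hτc.continuousAt
  have hσcont : ContinuousAt σ 0 := hσc.continuousAt
  have huc' : ContDiffAt ℝ n u 0 := huc.of_le (by norm_cast; omega)
  have hUev : ∀ᶠ p in 𝓝 (0 : ℝ × ℝ), γ p ∈ U :=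
    hγc.continuousAt.eventually (by rw [hγ0]; exact hU.mem_nhds hmem)
  set α : ℝ → ℝ × ℝ := fun x => (x, x * τ x) with hα
  set β : ℝ → ℝ × ℝ := fun x => (x * σ x, x) with hβ
  have hα0 : α 0 = 0 := by simp [hα, Prod.zero_eq_mk]
  have hβ0 : β 0 = 0 := by simp [hβ, Prod.zero_eq_mk]
  have hαc : ContDiffAt ℝ n α 0 := contDiffAt_id.prodMk (contDiffAt_id.mul hτc)
  have hβc : ContDiffAt ℝ n β 0 := (contDiffAt_id.mul hσc).prodMk contDiffAt_id
  have hαt : Tendsto α (𝓝 0) (𝓝 0) := by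
    have := hαc.continuousAt
    rwa [ContinuousAt, hα0] at this
  have hβt : Tendsto β (𝓝 0) (𝓝 0) := by
    have := hβc.continuousAt
    rwa [ContinuousAt, hβ0] at this
  have huα : ContDiffAt ℝ n (fun x => u (α x)) 0 :=
    ContDiffAt.comp (0 : ℝ) (by rw [hα0]; exact huc') hαc
  have huβ : ContDiffAt ℝ n (fun x => u (β x)) 0 :=
    ContDiffAt.comp (0 : ℝ) (by rw [hβ0]; exact huc') hβc
  set M : ℝ := |σ 0| + 1 with hM
  have hMpos : 0 < M := by positivity
  have hτM : ∀ᶠ x in 𝓝 (0:ℝ), |τ x| * M < 1 := by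
    have : ContinuousAt (fun x => |τ x| * M) 0 := by fun_prop
    exact this.eventually (gt_mem_nhds (by simp [hτ0]))
  have hσM : ∀ᶠ x in 𝓝 (0:ℝ), |σ x| < M := by
    have : ContinuousAt (fun x => |σ x|) 0 := by fun_prop
    exact this.eventually (gt_mem_nhds (by simp [hM]))
  have hev1 : ∀ᶠ x in 𝓝 (0:ℝ), ContDiffAt ℝ n (fun x => u (α x)) x ∧ γ (α x) ∈ U ∧
      F (γ (α x)) = 0 ∧ φ (u (α x) - u₀) = x * τ x ∧ |τ x| * M < 1 := by
    filter_upwards [huα.eventually (by simp), hαt.eventually hUev, hαt.eventually hus, hτs, hτM]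
      with x h1 h2 h3 h4 h5
    refine ⟨h1, h2, ?_, h3.1, h5⟩
    have h6 : ℓ (F (γ (α x))) = 0 := h4
    have h7 := h3.2
    change F (γ (α x)) = ℓ (F (γ (α x))) • w₁ at h7
    rw [h7, h6, zero_smul]
  have hev2 : ∀ᶠ x in 𝓝 (0:ℝ), ContDiffAt ℝ n σ x ∧ ContDiffAt ℝ n (fun x => u (β x)) x ∧
      γ (β x) ∈ U ∧ F (γ (β x)) = 0 ∧ φ (u (β x) - u₀) = x ∧ |σ x| < M := by
    filter_upwards [hσc.eventually (by simp), huβ.eventually (by simp), hβt.eventually hUev,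
      hβt.eventually hus, hσs, hσM] with x h0 h1 h2 h3 h4 h5
    refine ⟨h0, h1, h2, ?_, h3.1, h5⟩
    have h6 : ℓ (F (γ (β x))) = 0 := h4
    have h7 := h3.2
    change F (γ (β x)) = ℓ (F (γ (β x))) • w₁ at h7
    rw [h7, h6, zero_smul]
  obtain ⟨δ, hδ, hev1⟩ := Metric.eventually_nhds_iff.1 hev1
  obtain ⟨ε₀, hε₀, hev2⟩ := Metric.eventually_nhds_iff.1 hev2
  have hI1 : ∀ l ∈ Ioo (lam₀ - δ) (lam₀ + δ), dist (l - lam₀) 0 < δ := by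
    intro l hl
    rw [Real.dist_eq, sub_zero, abs_lt]
    constructor <;> linarith [hl.1, hl.2]
  have hI2 : ∀ x ∈ Ioo (-ε₀) ε₀, dist x 0 < ε₀ := by
    intro l hl
    rw [Real.dist_eq, sub_zero, abs_lt]
    exact hl
  have hWev : ∀ᶠ z in 𝓝 (lam₀, u₀), z ∈ U ∧ (F z = 0 →
      z ∈ {p : ℝ × X | ∃ l ∈ Ioo (lam₀ - δ) (lam₀ + δ), p = (l, u (α (l - lam₀)))} ∪
            {p : ℝ × X | ∃ ε ∈ Ioo (-ε₀) ε₀, p = (lam₀ + ε * σ ε, u (β ε))}) := by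
    have hPt : Tendsto (fun z : ℝ × X => (z.1 - lam₀, φ (z.2 - u₀))) (𝓝 (lam₀, u₀)) (𝓝 0) := by
      have : Continuous (fun z : ℝ × X => (z.1 - lam₀, φ (z.2 - u₀))) := by fun_prop
      have := this.tendsto (lam₀, u₀)
      simpa [Prod.zero_eq_mk] using this
    have hsm : ∀ᶠ p in 𝓝 (0 : ℝ × ℝ), |p.1| < δ ∧ |p.2| < ε₀ := by
      have h1 : ContinuousAt (fun p : ℝ × ℝ => |p.1|) 0 := by fun_prop
      have h2 : ContinuousAt (fun p : ℝ × ℝ => |p.2|) 0 := by fun_prop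
      filter_upwards [h1.eventually (gt_mem_nhds (by simpa using hδ)),
        h2.eventually (gt_mem_nhds (by simpa using hε₀))] with p h3 h4 using ⟨h3, h4⟩
    filter_upwards [hU.mem_nhds hmem, huu, hPt.eventually hex, hPt.eventually hsm]
      with z h1 h2 h3 h4
    refine ⟨h1, fun hz => ?_⟩
    have h2 := h2 hz
    set p : ℝ × ℝ := (z.1 - lam₀, φ (z.2 - u₀)) with hp
    have hγp : γ p = z := by
      ext
      · simp [hγ, hp]
      · exact h2
    have h3 := h3 (by simp [hγp, hf, hz])
    have hp1 := abs_lt.1 h4.1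
    have hp2 := abs_lt.1 h4.2
    rcases h3 with h3 | h3
    · left
      refine ⟨z.1, ⟨by linarith [hp1.1], by linarith [hp1.2]⟩, ?_⟩
      have : α (z.1 - lam₀) = p := by
        ext
        · rfl
        · exact h3.symm
      rw [this, h2]
    · right
      refine ⟨p.2, hp2, ?_⟩
      have : β p.2 = p := by
        ext
        · exact h3.symm
        · rfl
      rw [this, h2, ← h3]
      simp [hp]
  obtain ⟨W, hW, hWo, hWm⟩ := eventually_nhds_iff.1 hWev
  refine ⟨ε₀, δ, W, fun ε => lam₀ + ε * σ ε, fun ε => u (β ε), fun l => u (α (l - lam₀)),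
    hε₀, hδ, hWo, hWm, fun z hz => (hW z hz).1, ?_, ?_, by simp, by simp [hβ0, hu0], ?_, ?_, ?_,
    by simp [hα0, hu0], ?_, ?_, ?_, fun z hz => (hW z hz).2⟩
  · intro x hx
    exact (contDiffAt_const.add (contDiffAt_id.mul (hev2 (hI2 x hx)).1)).contDiffWithinAt
  · intro x hx
    exact (hev2 (hI2 x hx)).2.1.contDiffWithinAt
  · have hσd : HasDerivAt σ (deriv σ 0) 0 := (hσc.differentiableAt hn0).hasDerivAt
    have hβd : HasDerivAt β (σ 0, 1) 0 := by
      have := ((hasDerivAt_id (0:ℝ)).mul hσd).prodMk (hasDerivAt_id (0:ℝ))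
      exact this.congr_deriv (by simp)
    rw [← hβ0] at hud
    have := (hud.comp_hasDerivAt (0:ℝ) hβd).deriv
    simp only [Function.comp_def] at this
    rw [this]
    simp
  · intro x hx
    obtain ⟨-, -, h3, h4, -⟩ := hev2 (hI2 x hx)
    exact ⟨h3, h4⟩
  · intro l hl
    have h1 := (hev1 (hI1 l hl)).1
    have : ContDiffAt ℝ n (fun l : ℝ => l - lam₀) l := contDiffAt_id.sub contDiffAt_const
    exact (ContDiffAt.comp l h1 this).contDiffWithinAt
  · have hτd : HasDerivAt τ (deriv τ 0) 0 := (hτc.differentiableAt hn0).hasDerivAt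
    have hαd : HasDerivAt α (1, 0) 0 := by
      have := (hasDerivAt_id (0:ℝ)).prodMk ((hasDerivAt_id (0:ℝ)).mul hτd)
      exact this.congr_deriv (by simp [hτ0])
    rw [← hα0] at hud
    have h1 := hud.comp_hasDerivAt (0:ℝ) hαd
    rw [← sub_self lam₀] at h1
    have h2 := (h1.comp_sub_const lam₀ lam₀).deriv
    simp only [Function.comp_def] at h2
    rw [h2]
    simp
  · intro l hl
    obtain ⟨-, h2, h3, -⟩ := hev1 (hI1 l hl)
    have : γ (α (l - lam₀)) = (l, u (α (l - lam₀))) := by simp [hγ, hα]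
    rw [this] at h2 h3
    exact ⟨h2, h3⟩
  · ext z
    constructor
    · rintro ⟨⟨l, hl, hz1⟩, ⟨ε, hε, hz2⟩⟩
      obtain ⟨-, -, -, h4, h5⟩ := hev1 (hI1 l hl)
      obtain ⟨-, -, -, -, k4, k5⟩ := hev2 (hI2 ε hε)
      rw [hz1, Prod.mk.injEq] at hz2
      obtain ⟨e1, e2⟩ := hz2
      beta_reduce at e1 e2 hz1
      rw [e2, k4] at h4
      set x := l - lam₀ with hx
      have e3 : x = ε * σ ε := by rw [hx, e1]; ring
      have e4 : x * (1 - τ x * σ ε) = 0 := by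
        have : x = x * τ x * σ ε := by rw [← h4]; exact e3
        linarith
      have e5 : |τ x * σ ε| < 1 := by
        rw [abs_mul]
        exact (mul_le_mul_of_nonneg_left k5.le (abs_nonneg _)).trans_lt h5
      have e6 : x = 0 := by
        rcases mul_eq_zero.1 e4 with h | h
        · exact h
        · have := (abs_lt.1 e5).2
          linarith
      have e7 : l = lam₀ := by linarith
      rw [hz1, e6, hα0, hu0, e7]
      rfl
    · intro hz
      rw [mem_singleton_iff] at hz
      refine ⟨⟨lam₀, ⟨by linarith, by linarith⟩, ?_⟩, ⟨0, ⟨by linarith, by linarith⟩, ?_⟩⟩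
      · simp [hz, hα0, hu0]
      · simp [hz, hβ0, hu0]
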